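/- Let φ* : C^∞(V) → A be an ℝ-algebra homomorphism, where V ⊆ ℝⁿ is open (and star-shaped around the relevant point) and A = C^∞(|Ω|)[η¹,…,η^q]₀. Fix x₀ ∈ |Ω| and evaluate at x₀, obtaining an algebra map into ℝ[η¹,…,η^q]₀. Suppose each coordinate image φ*(y^α)(x₀) decomposes as y₀^α + n^α with y₀^α ∈ ℝ and n^α nilpotent (in the Grassmann augmentation ideal), where y₀ ∈ V. Then for every smooth F on V, (φ*F)(x₀) = Σ_{|r| ≤ ⌊q/2⌋} (∂^r F/∂y^r)(y₀) · (φ*y − y₀)^r(x₀) / r!. -/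

import Mathlib

open Manifold
open scoped Classical

/-- Partial derivative `∂/∂yⁱ` within a set `V ⊆ ℝⁿ`. -/
noncomputable def partialDIn {n : ℕ} (V : Set (EuclideanSpace ℝ (Fin n)))
    (i : Fin n) (F : EuclideanSpace ℝ (Fin n) → ℝ) :
    EuclideanSpace ℝ (Fin n) → ℝ :=
  fun y => fderivWithin ℝ F V y (EuclideanSpace.single i 1)

/-- Iterated partial derivative `∂^r F/∂y^r` within `V`. -/
noncomputable def partialPowIn {n : ℕ} (V : Set (EuclideanSpace ℝ (Fin n)))
    (r : Fin n → ℕ) (F : EuclideanSpace ℝ (Fin n) → ℝ) :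
    EuclideanSpace ℝ (Fin n) → ℝ :=
  (List.finRange n).foldr (fun i G => (partialDIn V i)^[r i] G) F

/-- The extension by `0` of a function defined on an open set. -/

noncomputable def extendFn {n : ℕ}
    (V : TopologicalSpace.Opens (EuclideanSpace ℝ (Fin n))) (f : V → ℝ) :
    EuclideanSpace ℝ (Fin n) → ℝ :=
  fun z => if h : z ∈ V then f ⟨z, h⟩ else 0

universe u

theorem continuousOn_intervalIntegral_of_continuousOn_prod {X G : Type*} [TopologicalSpace X]
    [FirstCountableTopology X] [NormedAddCommGroup G] [NormedSpace ℝ G]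
    {V : Set X} {f : X → ℝ → G}
    (hf : ContinuousOn (fun p : X × ℝ => f p.1 p.2) (V ×ˢ Set.Icc (0 : ℝ) 1)) :
    ContinuousOn (fun y => ∫ t in (0 : ℝ)..1, f y t) V := by
  rw [continuousOn_iff_continuous_domRestrict]
  have hc : Continuous (Function.uncurry fun (y : V) (t : ℝ) =>
      f y (Set.projIcc (0 : ℝ) 1 zero_le_one t)) := by
    refine hf.comp_continuous (f := fun p : V × ℝ =>
      ((p.1 : X), (Set.projIcc (0 : ℝ) 1 zero_le_one p.2 : ℝ))) ?_ ?_
    · exact (continuous_subtype_val.comp continuous_fst).prodMk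
        (continuous_subtype_val.comp (continuous_projIcc.comp continuous_snd))
    · exact fun p => ⟨p.1.2, Subtype.mem _⟩
  refine (intervalIntegral.continuous_parametric_intervalIntegral_of_continuous'
    (μ := MeasureTheory.volume) hc 0 1).congr fun y => ?_
  refine intervalIntegral.integral_congr fun t ht => ?_
  rw [Set.uIcc_of_le zero_le_one] at ht
  simp only [Set.projIcc_of_mem zero_le_one ht]

theorem continuousOn_segment_smul {E G : Type*} [NormedAddCommGroup E] [NormedSpace ℝ E]
    [NormedAddCommGroup G] [NormedSpace ℝ G] {V : Set E} {y₀ : E} (hstar : StarConvex ℝ y₀ V)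
    {w : ℝ → ℝ} (hw : Continuous w) {h : E → G} (hh : ContinuousOn h V) :
    ContinuousOn (fun p : E × ℝ => w p.2 • h (y₀ + p.2 • (p.1 - y₀)))
      (V ×ˢ Set.Icc (0 : ℝ) 1) := by
  refine (hw.comp continuous_snd).continuousOn.smul
    (hh.comp (Continuous.continuousOn (by fun_prop)) ?_)
  exact fun p hp => hstar.add_smul_sub_mem hp.1 hp.2.1 hp.2.2

theorem hasFDerivAt_integral_segment {E G : Type*} [NormedAddCommGroup E] [NormedSpace ℝ E]
    [ProperSpace E] [NormedAddCommGroup G] [NormedSpace ℝ G]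
    {V : Set E} (hV : IsOpen V) {y₀ : E} (hstar : StarConvex ℝ y₀ V)
    {w : ℝ → ℝ} (hw : Continuous w) {h : E → G} (hd : DifferentiableOn ℝ h V)
    (hh : ContinuousOn (fderiv ℝ h) V) {y : E} (hy : y ∈ V) :
    HasFDerivAt (fun y => ∫ t in (0 : ℝ)..1, w t • h (y₀ + t • (y - y₀)))
      (∫ t in (0 : ℝ)..1, (w t * t) • fderiv ℝ h (y₀ + t • (y - y₀))) y := by
  obtain ⟨ε, hε, hball⟩ := Metric.nhds_basis_closedBall.mem_iff.1 (hV.mem_nhds hy)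
  have hF := continuousOn_segment_smul hstar hw hd.continuousOn
  have hF' := continuousOn_segment_smul hstar (hw.mul continuous_id) hh
  obtain ⟨C, hC⟩ := ((isCompact_closedBall y ε).prod
    (isCompact_Icc (a := (0 : ℝ)) (b := 1))).exists_bound_of_continuousOn
    (hF'.mono (Set.prod_mono hball subset_rfl))
  have hslice : ∀ z ∈ V, Set.MapsTo (fun t : ℝ => (z, t)) (Set.uIcc (0 : ℝ) 1)
      (V ×ˢ Set.Icc (0 : ℝ) 1) := by
    intro z hz t ht
    rw [Set.uIcc_of_le zero_le_one] at ht
    exact ⟨hz, ht⟩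
  have hint : ∀ z ∈ V, IntervalIntegrable (fun t => w t • h (y₀ + t • (z - y₀)))
      MeasureTheory.volume 0 1 := fun z hz =>
    (hF.comp (Continuous.continuousOn (by fun_prop)) (hslice z hz)).intervalIntegrable
  have hint' : IntervalIntegrable (fun t => (w t * t) • fderiv ℝ h (y₀ + t • (y - y₀)))
      MeasureTheory.volume 0 1 :=
    (hF'.comp (Continuous.continuousOn (by fun_prop)) (hslice y hy)).intervalIntegrable
  refine intervalIntegral.hasFDerivAt_integral_of_dominated_of_fderiv_le (bound := fun _ => C)
    (F' := fun z t => (w t * t) • fderiv ℝ h (y₀ + t • (z - y₀)))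
    (Metric.closedBall_mem_nhds y hε) ?_ (hint y hy) ?_ ?_ intervalIntegrable_const ?_
  · filter_upwards [hV.mem_nhds hy] with z hz
    exact (intervalIntegrable_iff.1 (hint z hz)).aestronglyMeasurable
  · exact (intervalIntegrable_iff.1 hint').aestronglyMeasurable
  · refine Filter.Eventually.of_forall fun t ht z hz => hC (z, t) ⟨hz, ?_⟩
    rw [Set.uIoc_of_le zero_le_one] at ht
    exact Set.Ioc_subset_Icc_self ht
  · refine Filter.Eventually.of_forall fun t ht z hz => ?_
    rw [Set.uIoc_of_le zero_le_one] at ht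
    have hmem := hstar.add_smul_sub_mem (hball hz) ht.1.le ht.2
    have h1 : HasFDerivAt (fun z : E => y₀ + t • (z - y₀)) (t • ContinuousLinearMap.id ℝ E) z :=
      (((hasFDerivAt_id z).sub_const y₀).const_smul t).const_add y₀
    have h2 := (((hd.differentiableAt (hV.mem_nhds hmem)).hasFDerivAt).comp z h1).const_smul (w t)
    refine h2.congr_fderiv ?_
    ext v
    simp [mul_smul]

theorem contDiffOn_integral_segment {E G : Type u} [NormedAddCommGroup E]
    [NormedSpace ℝ E] [FiniteDimensional ℝ E] [NormedAddCommGroup G] [NormedSpace ℝ G]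
    {V : Set E} (hV : IsOpen V) {y₀ : E} (hstar : StarConvex ℝ y₀ V) (m : ℕ)
    {w : ℝ → ℝ} (hw : Continuous w) {h : E → G} (hh : ContDiffOn ℝ m h V) :
    ContDiffOn ℝ m (fun y => ∫ t in (0 : ℝ)..1, w t • h (y₀ + t • (y - y₀))) V := by
  have : ProperSpace E := FiniteDimensional.proper ℝ E
  induction m generalizing G w h with
  | zero =>
    rw [Nat.cast_zero, contDiffOn_zero] at hh ⊢
    exact continuousOn_intervalIntegral_of_continuousOn_prod
      (continuousOn_segment_smul hstar hw hh)
  | succ m ih =>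
    rw [Nat.cast_succ] at hh ⊢
    obtain ⟨hd, -, hd'⟩ := (contDiffOn_succ_iff_fderiv_of_isOpen hV).1 hh
    have hK := fun y hy => hasFDerivAt_integral_segment hV hstar hw hd hd'.continuousOn (y := y) hy
    refine (contDiffOn_succ_iff_fderiv_of_isOpen hV).2
      ⟨fun y hy => (hK y hy).differentiableAt.differentiableWithinAt, by simp, ?_⟩
    exact (ih (hw.mul continuous_id) hd').congr fun y hy => (hK y hy).fderiv

/-- Hadamard's lemma on an open star-convex set. -/
theorem exists_contDiffOn_eq_add_sum_mul {n : ℕ} {V : Set (EuclideanSpace ℝ (Fin n))}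
    (hV : IsOpen V) {y₀ : EuclideanSpace ℝ (Fin n)} (hstar : StarConvex ℝ y₀ V)
    {F : EuclideanSpace ℝ (Fin n) → ℝ} (hF : ContDiffOn ℝ (⊤ : ℕ∞) F V) :
    ∃ g : Fin n → EuclideanSpace ℝ (Fin n) → ℝ, (∀ i, ContDiffOn ℝ (⊤ : ℕ∞) (g i) V) ∧
      ∀ y ∈ V, F y = F y₀ + ∑ i, (y i - y₀ i) * g i y := by
  have hF' : ContDiffOn ℝ (⊤ : ℕ∞) (fderiv ℝ F) V := hF.fderiv_of_isOpen hV le_rfl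
  have hFi : ∀ i, ContDiffOn ℝ (⊤ : ℕ∞)
      (fun z => fderiv ℝ F z (EuclideanSpace.single i 1)) V :=
    fun i => hF'.clm_apply contDiffOn_const
  refine ⟨fun i y => ∫ t in (0 : ℝ)..1, (1 : ℝ) •
    fderiv ℝ F (y₀ + t • (y - y₀)) (EuclideanSpace.single i 1), fun i => ?_, fun y hy => ?_⟩
  · exact contDiffOn_infty.2 fun m => contDiffOn_integral_segment hV hstar m continuous_const
      ((hFi i).of_le (by exact_mod_cast le_top))
  · have hseg : ∀ t ∈ Set.uIcc (0 : ℝ) 1, y₀ + t • (y - y₀) ∈ V := by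
      intro t ht
      rw [Set.uIcc_of_le zero_le_one] at ht
      exact hstar.add_smul_sub_mem hy ht.1 ht.2
    have hint : ∀ i, IntervalIntegrable (fun t : ℝ => (y i - y₀ i) * ((1 : ℝ) •
        fderiv ℝ F (y₀ + t • (y - y₀)) (EuclideanSpace.single i 1)))
        MeasureTheory.volume 0 1 := by
      intro i
      refine ContinuousOn.intervalIntegrable ?_
      simp only [one_smul]
      exact continuousOn_const.mul ((hFi i).continuousOn.comp
        (Continuous.continuousOn (f := fun t : ℝ => y₀ + t • (y - y₀)) (by fun_prop)) hseg)
    simp_rw [← intervalIntegral.integral_const_mul]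
    rw [← intervalIntegral.integral_finsetSum fun i _ => hint i, ← sub_eq_iff_eq_add']
    have hsum : y - y₀ = ∑ i, (y i - y₀ i) • EuclideanSpace.single i (1 : ℝ) := by
      ext j
      simp [Pi.single_apply]
    have happly : ∀ L : EuclideanSpace ℝ (Fin n) →L[ℝ] ℝ,
        L (y - y₀) = ∑ i, (y i - y₀ i) * ((1 : ℝ) • L (EuclideanSpace.single i 1)) := by
      intro L
      conv_lhs => rw [hsum]
      simp
    have hderiv : ∀ t ∈ Set.uIcc (0 : ℝ) 1, HasDerivAt (fun t : ℝ => F (y₀ + t • (y - y₀)))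
        (∑ i, (y i - y₀ i) * ((1 : ℝ) •
          fderiv ℝ F (y₀ + t • (y - y₀)) (EuclideanSpace.single i 1))) t := by
      intro t ht
      have h1 : HasDerivAt (fun t : ℝ => y₀ + t • (y - y₀)) (y - y₀) t := by
        simpa using ((hasDerivAt_id t).smul_const (y - y₀)).const_add y₀
      have h2 := ((hF.differentiableOn (by simp)).differentiableAt
        (hV.mem_nhds (hseg t ht))).hasFDerivAt.comp_hasDerivAt t h1
      exact h2.congr_deriv (happly _)
    rw [intervalIntegral.integral_eq_sub_of_hasDerivAt hderiv]
    · simp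
    · simpa only [Finset.sum_fn] using IntervalIntegrable.sum Finset.univ fun i _ => hint i

theorem exteriorAlgebra_range_ι_pow_eq_bot {q m : ℕ} (h : q < m) :
    LinearMap.range (ExteriorAlgebra.ι ℝ (M := Fin q → ℝ)) ^ m = ⊥ := by
  change ⋀[ℝ]^m (Fin q → ℝ) = ⊥
  rw [← ExteriorAlgebra.ιMulti_span_fixedDegree, Submodule.span_eq_bot]
  rintro _ ⟨v, rfl⟩
  refine AlternatingMap.map_linearDependent _ v fun hv => ?_
  have := hv.fintype_card_le_finrank
  simp at this
  omega

/-- The elements of the Grassmann algebra whose components have degree at least `d`. -/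
def grassmannFiltration (q d : ℕ) : Submodule ℝ (ExteriorAlgebra ℝ (Fin q → ℝ)) :=
  ⨆ m : {m : ℕ // d ≤ m}, LinearMap.range (ExteriorAlgebra.ι ℝ (M := Fin q → ℝ)) ^ (m : ℕ)

theorem range_ι_pow_le_grassmannFiltration (q : ℕ) {d m : ℕ} (h : d ≤ m) :
    LinearMap.range (ExteriorAlgebra.ι ℝ (M := Fin q → ℝ)) ^ m ≤ grassmannFiltration q d :=
  le_iSup (fun m : {m : ℕ // d ≤ m} =>
    LinearMap.range (ExteriorAlgebra.ι ℝ (M := Fin q → ℝ)) ^ (m : ℕ)) ⟨m, h⟩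

theorem grassmannFiltration_mul_le (q a b : ℕ) :
    grassmannFiltration q a * grassmannFiltration q b ≤ grassmannFiltration q (a + b) := by
  unfold grassmannFiltration
  rw [Submodule.iSup_mul]
  refine iSup_le fun m => ?_
  rw [Submodule.mul_iSup]
  refine iSup_le fun l => ?_
  rw [← pow_add]
  exact range_ι_pow_le_grassmannFiltration q (add_le_add m.2 l.2)

theorem grassmannFiltration_eq_bot {q d : ℕ} (h : q < d) : grassmannFiltration q d = ⊥ := by
  unfold grassmannFiltration
  exact iSup_eq_bot.2 fun m => exteriorAlgebra_range_ι_pow_eq_bot (h.trans_le m.2)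

theorem algebraMapInv_eq_zero_of_mem_grassmannFiltration {q : ℕ}
    {z : ExteriorAlgebra ℝ (Fin q → ℝ)} (hz : z ∈ grassmannFiltration q 1) :
    ExteriorAlgebra.algebraMapInv z = 0 := by
  have hι : LinearMap.range (ExteriorAlgebra.ι ℝ (M := Fin q → ℝ)) ≤
      LinearMap.ker (ExteriorAlgebra.algebraMapInv (R := ℝ) (M := Fin q → ℝ)).toLinearMap := by
    rintro _ ⟨v, rfl⟩
    simp [ExteriorAlgebra.algebraMapInv]
  suffices grassmannFiltration q 1 ≤
      LinearMap.ker (ExteriorAlgebra.algebraMapInv (R := ℝ) (M := Fin q → ℝ)).toLinearMap from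
    this hz
  refine iSup_le fun m => ?_
  obtain ⟨m, hm⟩ := m
  obtain ⟨m, rfl⟩ := Nat.exists_eq_succ_of_ne_zero (Nat.one_le_iff_ne_zero.1 hm)
  rw [pow_succ, Submodule.mul_le]
  intro a _ b hb
  have := hι hb
  simp_all

/-- Even elements of the augmentation ideal have degree at least two. -/
theorem mem_grassmannFiltration_two {q : ℕ} {x : ExteriorAlgebra ℝ (Fin q → ℝ)}
    (hx : x ∈ CliffordAlgebra.even (0 : QuadraticForm ℝ (Fin q → ℝ)))
    (hx0 : ExteriorAlgebra.algebraMapInv x = 0) : x ∈ grassmannFiltration q 2 := by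
  have hle : CliffordAlgebra.evenOdd (0 : QuadraticForm ℝ (Fin q → ℝ)) 0 ≤
      (1 : Submodule ℝ (ExteriorAlgebra ℝ (Fin q → ℝ))) ⊔ grassmannFiltration q 2 := by
    refine iSup_le fun ⟨m, hm⟩ => ?_
    rcases Nat.eq_zero_or_pos m with rfl | hpos
    · exact le_sup_of_le_left (pow_zero _).le
    · rw [ZMod.natCast_eq_zero_iff] at hm
      exact le_sup_of_le_right (range_ι_pow_le_grassmannFiltration q (Nat.le_of_dvd hpos hm))
  obtain ⟨c, hc, z, hz, rfl⟩ := Submodule.mem_sup.1 (hle hx)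
  obtain ⟨c, rfl⟩ := Submodule.mem_one.1 hc
  have hz1 : z ∈ grassmannFiltration q 1 :=
    iSup_le (fun m => range_ι_pow_le_grassmannFiltration q (one_le_two.trans m.2)) hz
  rw [map_add, algebraMapInv_eq_zero_of_mem_grassmannFiltration hz1, add_zero,
    ExteriorAlgebra.algebraMap_leftInverse] at hx0
  simpa [hx0] using hz

/-- The iterated derivation `∏ i ∈ l, (D i) ^ r i`, the head of `l` acting last. -/
def iterDerivation {σ A : Type*} (D : σ → A → A) (r : σ → ℕ) (l : List σ) (a : A) : A :=
  l.foldr (fun i b => (D i)^[r i] b) a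

@[simp]
theorem iterDerivation_nil {σ A : Type*} (D : σ → A → A) (r : σ → ℕ) (a : A) :
    iterDerivation D r [] a = a :=
  rfl

@[simp]
theorem iterDerivation_cons {σ A : Type*} (D : σ → A → A) (r : σ → ℕ) (i : σ) (l : List σ)
    (a : A) : iterDerivation D r (i :: l) a = (D i)^[r i] (iterDerivation D r l a) :=
  rfl

theorem iterDerivation_semiconj {σ A B : Type*} (φ : A → B) (D : σ → A → A) (E : σ → B → B)
    (h : ∀ i a, φ (D i a) = E i (φ a)) (r : σ → ℕ) (l : List σ) (a : A) :
    φ (iterDerivation D r l a) = iterDerivation E r l (φ a) := by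
  induction l with
  | nil => rfl
  | cons i l ih =>
    rw [iterDerivation_cons, iterDerivation_cons, ← ih]
    exact (Function.Semiconj.iterate_right (f := φ) (h i) (r i)) _

section Derivations

variable {σ A : Type*} [CommRing A] [Algebra ℝ A]

theorem derivation_mem_ideal_pow (D : Derivation ℝ A A) (I : Ideal A) {k : ℕ} {x : A}
    (hx : x ∈ I ^ (k + 1)) : D x ∈ I ^ k := by
  induction k generalizing x with
  | zero => simp
  | succ k ih =>
    rw [pow_succ] at hx
    refine Submodule.mul_induction_on hx (fun a ha b hb => ?_) fun a b ha hb => ?_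
    · rw [D.leibniz, smul_eq_mul, smul_eq_mul]
      refine Ideal.add_mem _ (Ideal.mul_mem_right _ _ ha) ?_
      rw [pow_succ']
      exact Ideal.mul_mem_mul hb (ih ha)
    · rw [map_add]
      exact Ideal.add_mem _ ha hb

theorem iterate_derivation_mem_ideal_pow (D : Derivation ℝ A A) (I : Ideal A) {k : ℕ} (m : ℕ)
    {x : A} (hx : x ∈ I ^ (k + m)) : D^[m] x ∈ I ^ k := by
  induction m generalizing k with
  | zero => exact hx
  | succ m ih =>
    rw [Function.iterate_succ_apply']
    exact derivation_mem_ideal_pow D I (ih (by rwa [add_right_comm, add_assoc]))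

theorem iterDerivation_mem_ideal_pow (D : σ → Derivation ℝ A A) (I : Ideal A) (r : σ → ℕ)
    {k : ℕ} (l : List σ) {x : A} (hx : x ∈ I ^ (k + (l.map r).sum)) :
    iterDerivation (fun i => D i) r l x ∈ I ^ k := by
  induction l generalizing k with
  | nil => simpa using hx
  | cons i l ih =>
    refine iterate_derivation_mem_ideal_pow (D i) I (r i) (ih ?_)
    rwa [add_assoc, ← List.sum_cons, ← List.map_cons]

theorem iterDerivation_sub (D : σ → Derivation ℝ A A) (r : σ → ℕ) (l : List σ) (x y : A) :
    iterDerivation (fun i => D i) r l (x - y) =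
      iterDerivation (fun i => D i) r l x - iterDerivation (fun i => D i) r l y := by
  induction l with
  | nil => rfl
  | cons i l ih =>
    simp only [iterDerivation_cons, ih, iterate_map_sub]

theorem coeff_iterate_pderiv (i : σ) (m : ℕ) (p : MvPolynomial σ ℝ) (s : σ →₀ ℕ) :
    (((MvPolynomial.pderiv i)^[m] p).coeff s) =
      p.coeff (s + Finsupp.single i m) * ((s i + 1).ascFactorial m : ℕ) := by
  induction m generalizing s with
  | zero => simp
  | succ m ih =>
    rw [Function.iterate_succ_apply', MvPolynomial.coeff_pderiv, ih, add_assoc,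
      ← Finsupp.single_add, add_comm 1 m, Nat.ascFactorial_succ,
      ← Nat.succ_ascFactorial, Finsupp.add_apply, Finsupp.single_eq_same]
    push_cast
    ring

theorem coeff_iterDerivation_pderiv (r : σ → ℕ) (l : List σ) (hl : l.Nodup)
    (p : MvPolynomial σ ℝ) (s : σ →₀ ℕ) (hs : ∀ i ∈ l, s i = 0) :
    (iterDerivation (fun i => MvPolynomial.pderiv i) r l p).coeff s =
      p.coeff (s + (l.map fun i => Finsupp.single i (r i)).sum) *
        ((l.map fun i => (r i).factorial).prod : ℕ) := by
  induction l generalizing s with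
  | nil => simp [iterDerivation]
  | cons i l ih =>
    rw [List.nodup_cons] at hl
    rw [iterDerivation_cons, coeff_iterate_pderiv, hs i List.mem_cons_self, ih hl.2]
    · simp [add_assoc, Nat.one_ascFactorial]
      ring
    · intro j hj
      have : i ≠ j := fun h => hl.1 (h ▸ hj)
      simp [hs j (List.mem_cons_of_mem _ hj), this]

theorem exists_sub_aeval_mem_ideal_pow [Fintype σ] (ε : A →ₐ[ℝ] ℝ) (u : σ → A)
    (hadamard : ∀ f, ∃ g : σ → A, f = algebraMap ℝ A (ε f) + ∑ i, u i * g i) (k : ℕ) (f : A) :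
    ∃ p : MvPolynomial σ ℝ, f - MvPolynomial.aeval u p ∈ Ideal.span (Set.range u) ^ k := by
  induction k generalizing f with
  | zero => exact ⟨0, by simp⟩
  | succ k ih =>
    obtain ⟨g, hg⟩ := hadamard f
    choose p hp using fun i => ih (g i)
    refine ⟨MvPolynomial.C (ε f) + ∑ i, MvPolynomial.X i * p i, ?_⟩
    have : f - MvPolynomial.aeval u (MvPolynomial.C (ε f) + ∑ i, MvPolynomial.X i * p i) =
        ∑ i, u i * (g i - MvPolynomial.aeval u (p i)) := by
      simp only [map_add, map_sum, map_mul, MvPolynomial.aeval_C, MvPolynomial.aeval_X, mul_sub,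
        Finset.sum_sub_distrib]
      rw [sub_eq_sub_iff_add_eq_add, add_comm (∑ i, u i * g i), add_right_comm, ← hg]
    rw [this]
    refine Ideal.sum_mem _ fun i _ => ?_
    rw [pow_succ']
    exact Ideal.mul_mem_mul (Ideal.subset_span ⟨i, rfl⟩) (hp i)

theorem derivation_aeval [DecidableEq σ] (D : σ → Derivation ℝ A A) (u : σ → A)
    (hDu : ∀ i j, D i (u j) = if i = j then 1 else 0) (i : σ) (p : MvPolynomial σ ℝ) :
    MvPolynomial.aeval u (MvPolynomial.pderiv i p) = D i (MvPolynomial.aeval u p) := by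
  induction p using MvPolynomial.induction_on with
  | C a => simp
  | add p q hp hq => simp [hp, hq]
  | mul_X p j hp =>
    simp [hp, hDu, MvPolynomial.pderiv_X, Pi.single_apply, eq_comm (a := j), apply_ite]

theorem eval_iterDerivation_aeval {n : ℕ} (D : Fin n → Derivation ℝ A A)
    (ε : A →ₐ[ℝ] ℝ) (u : Fin n → A) (hDu : ∀ i j, D i (u j) = if i = j then 1 else 0)
    (hεu : ∀ i, ε (u i) = 0) (r : Fin n → ℕ) (p : MvPolynomial (Fin n) ℝ) :
    ε (iterDerivation (fun i => D i) r (List.finRange n) (MvPolynomial.aeval u p)) =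
      p.coeff (Finsupp.equivFunOnFinite.symm r) * (∏ i, (r i).factorial : ℕ) := by
  rw [← iterDerivation_semiconj (MvPolynomial.aeval u) (fun i => MvPolynomial.pderiv i)
    (fun i => D i) (derivation_aeval D u hDu)]
  have hε : ∀ p : MvPolynomial (Fin n) ℝ, ε (MvPolynomial.aeval u p) = p.coeff 0 := by
    intro p
    have : (ε.comp (MvPolynomial.aeval u)) = MvPolynomial.aeval 0 :=
      MvPolynomial.algHom_ext fun i => by simp [hεu]
    rw [← AlgHom.comp_apply, this, MvPolynomial.aeval_zero]
    rfl
  rw [hε, coeff_iterDerivation_pderiv r _ (List.nodup_finRange n) p 0 (by simp), zero_add]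
  congr 2
  rw [← List.ofFn_eq_map, List.sum_ofFn]
  ext i
  simp [Finsupp.single_apply]

/-- The Taylor formula for an algebra map killing a power of the ideal of the base point. -/
theorem algHom_taylor {n k : ℕ} {B : Type*} [Ring B] [Algebra ℝ B]
    (D : Fin n → Derivation ℝ A A) (ε : A →ₐ[ℝ] ℝ) (u : Fin n → A)
    (hDu : ∀ i j, D i (u j) = if i = j then 1 else 0) (hεu : ∀ i, ε (u i) = 0)
    (hadamard : ∀ f, ∃ g : Fin n → A, f = algebraMap ℝ A (ε f) + ∑ i, u i * g i)
    (χ : A →ₐ[ℝ] B) (hχ : ∀ f ∈ Ideal.span (Set.range u) ^ (k + 1), χ f = 0)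
    (S : Finset (Fin n → ℕ)) (hS : ∀ r, r ∈ S ↔ ∑ i, r i ≤ k) (f : A) :
    χ f = ∑ r ∈ S, (ε (iterDerivation (fun i => D i) r (List.finRange n) f) /
      (∏ i, (r i).factorial : ℕ)) • (List.ofFn fun i => χ (u i) ^ r i).prod := by
  obtain ⟨p, hp⟩ := exists_sub_aeval_mem_ideal_pow ε u hadamard (k + 1) f
  have hεI : ∀ x ∈ Ideal.span (Set.range u), ε x = 0 := by
    suffices Ideal.span (Set.range u) ≤ RingHom.ker ε from fun x hx => this hx
    rw [Ideal.span_le]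
    rintro _ ⟨i, rfl⟩
    exact hεu i
  have hcoeff : ∀ r ∈ S, ε (iterDerivation (fun i => D i) r (List.finRange n) f) /
      (∏ i, (r i).factorial : ℕ) = p.coeff (Finsupp.equivFunOnFinite.symm r) := by
    intro r hr
    have hmem : iterDerivation (fun i => D i) r (List.finRange n) (f - MvPolynomial.aeval u p) ∈
        Ideal.span (Set.range u) ^ 1 := by
      refine iterDerivation_mem_ideal_pow D _ r _ (Ideal.pow_le_pow_right ?_ hp)
      rw [← List.ofFn_eq_map, List.sum_ofFn, add_comm]
      exact Nat.add_le_add_right ((hS r).1 hr) 1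
    rw [pow_one, iterDerivation_sub] at hmem
    have h := hεI _ hmem
    rw [map_sub, eval_iterDerivation_aeval D ε u hDu hεu, sub_eq_zero] at h
    rw [h, mul_div_cancel_right₀]
    exact Nat.cast_ne_zero.2 (Finset.prod_ne_zero_iff.2 fun i _ => (r i).factorial_ne_zero)
  rw [Finset.sum_congr rfl fun r hr => by rw [hcoeff r hr]]
  have hf : χ f = χ (MvPolynomial.aeval u p) := by
    rw [← sub_eq_zero, ← map_sub]
    exact hχ _ hp
  have hmon : ∀ r : Fin n → ℕ, (List.ofFn fun i => χ (u i) ^ r i).prod = χ (∏ i, u i ^ r i) := by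
    intro r
    rw [← List.prod_ofFn, map_list_prod, List.map_ofFn]
    simp [Function.comp_def]
  simp_rw [hf, hmon]
  clear hp hcoeff hf
  induction p using MvPolynomial.induction_on' with
  | monomial s a =>
    have hs : ∀ r : Fin n → ℕ, s = Finsupp.equivFunOnFinite.symm r ↔ (s : Fin n → ℕ) = r :=
      fun r => by rw [Equiv.eq_symm_apply]; rfl
    simp only [MvPolynomial.coeff_monomial, hs, ite_smul, zero_smul]
    rw [Finset.sum_ite_eq, MvPolynomial.aeval_monomial, Finsupp.prod_fintype _ _ (by simp)]
    split_ifs with h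
    · rw [← Algebra.smul_def, map_smul]
    · refine hχ _ (Ideal.mul_mem_left _ _ ?_)
      refine Ideal.pow_le_pow_right (Nat.succ_le_of_lt (not_le.1 ((hS _).not.1 h))) ?_
      rw [← Finset.prod_pow_eq_pow_sum]
      exact Ideal.prod_mem_prod fun i _ =>
        Ideal.pow_mem_pow (Ideal.subset_span (Set.mem_range_self i)) _
  | add p q hp hq =>
    simp only [map_add, MvPolynomial.coeff_add, add_smul, Finset.sum_add_distrib, hp, hq]

end Derivations

section SmoothFunctions

variable {n : ℕ} {V : TopologicalSpace.Opens (EuclideanSpace ℝ (Fin n))}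

theorem extendFn_coe (f : V → ℝ) (v : V) : extendFn V f v = f v := by
  simp [extendFn]

theorem contMDiff_restrict_iff {F : EuclideanSpace ℝ (Fin n) → ℝ} :
    ContMDiff (𝓡 n) 𝓘(ℝ, ℝ) (⊤ : ℕ∞) (fun v : V => F v) ↔
      ContDiffOn ℝ (⊤ : ℕ∞) F (V : Set (EuclideanSpace ℝ (Fin n))) := by
  constructor
  · intro h y hy
    exact (contMDiffAt_iff_contDiffAt.1
      (contMDiffAt_subtype_iff.1 (h ⟨y, hy⟩))).contDiffWithinAt
  · intro h v
    exact contMDiffAt_subtype_iff.2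
      (contMDiffAt_iff_contDiffAt.2 (h.contDiffAt (V.isOpen.mem_nhds v.2)))

theorem contDiffOn_extendFn (f : ContMDiffMap (𝓡 n) 𝓘(ℝ, ℝ) V ℝ (⊤ : ℕ∞)) :
    ContDiffOn ℝ (⊤ : ℕ∞) (extendFn V f) (V : Set (EuclideanSpace ℝ (Fin n))) := by
  rw [← contMDiff_restrict_iff]
  simpa only [extendFn_coe] using f.contMDiff

theorem partialDIn_congr {F G : EuclideanSpace ℝ (Fin n) → ℝ} (i : Fin n)
    (h : Set.EqOn F G (V : Set (EuclideanSpace ℝ (Fin n)))) :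
    Set.EqOn (partialDIn V i F) (partialDIn V i G) (V : Set (EuclideanSpace ℝ (Fin n))) := by
  intro y hy
  simp only [partialDIn, fderivWithin_congr h (h hy)]

theorem contDiffOn_partialDIn {F : EuclideanSpace ℝ (Fin n) → ℝ} (i : Fin n)
    (h : ContDiffOn ℝ (⊤ : ℕ∞) F (V : Set (EuclideanSpace ℝ (Fin n)))) :
    ContDiffOn ℝ (⊤ : ℕ∞) (partialDIn V i F) (V : Set (EuclideanSpace ℝ (Fin n))) :=
  (h.fderivWithin V.isOpen.uniqueDiffOn le_rfl).clm_apply contDiffOn_const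

/-- The derivation `∂/∂yⁱ` of `C^∞(V)`. -/
noncomputable def partialDerivation (V : TopologicalSpace.Opens (EuclideanSpace ℝ (Fin n)))
    (i : Fin n) :
    Derivation ℝ (ContMDiffMap (𝓡 n) 𝓘(ℝ, ℝ) V ℝ (⊤ : ℕ∞))
      (ContMDiffMap (𝓡 n) 𝓘(ℝ, ℝ) V ℝ (⊤ : ℕ∞)) :=
  Derivation.mk'
    { toFun := fun f => ⟨fun v => partialDIn V i (extendFn V f) v,
        contMDiff_restrict_iff.2 (contDiffOn_partialDIn i (contDiffOn_extendFn f))⟩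
      map_add' := fun f g => by
        ext v
        have hd := fun f : ContMDiffMap (𝓡 n) 𝓘(ℝ, ℝ) V ℝ (⊤ : ℕ∞) =>
          (contDiffOn_extendFn f).differentiableOn (by simp) v v.2
        have h : Set.EqOn (extendFn V (f + g)) (extendFn V f + extendFn V g) V := fun y hy => by
          simp [extendFn, show y ∈ V from hy]
        change partialDIn V i (extendFn V (f + g)) v = _
        rw [partialDIn_congr i h v.2, partialDIn,
          fderivWithin_add (V.isOpen.uniqueDiffOn v v.2) (hd f) (hd g)]
        rfl
      map_smul' := fun c f => by
        ext v
        have hd := (contDiffOn_extendFn f).differentiableOn (by simp) v v.2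
        have h : Set.EqOn (extendFn V (c • f)) (c • extendFn V f) V := fun y hy => by
          simp [extendFn, show y ∈ V from hy]
        change partialDIn V i (extendFn V (c • f)) v = _
        rw [partialDIn_congr i h v.2, partialDIn,
          fderivWithin_const_smul (V.isOpen.uniqueDiffOn v v.2) hd]
        rfl }
    fun f g => by
      ext v
      have hd := fun f : ContMDiffMap (𝓡 n) 𝓘(ℝ, ℝ) V ℝ (⊤ : ℕ∞) =>
        (contDiffOn_extendFn f).differentiableOn (by simp) v v.2
      have h : Set.EqOn (extendFn V (f * g)) (extendFn V f * extendFn V g) V := fun y hy => by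
        simp [extendFn, show y ∈ V from hy]
      change partialDIn V i (extendFn V (f * g)) v = f v * partialDIn V i (extendFn V g) v +
        g v * partialDIn V i (extendFn V f) v
      rw [partialDIn_congr i h v.2, partialDIn,
        fderivWithin_mul (V.isOpen.uniqueDiffOn v v.2) (hd f) (hd g), extendFn_coe, extendFn_coe]
      rfl

theorem partialDerivation_eq_of_eqOn {F : EuclideanSpace ℝ (Fin n) → ℝ} (i : Fin n)
    {f : ContMDiffMap (𝓡 n) 𝓘(ℝ, ℝ) V ℝ (⊤ : ℕ∞)} (h : ∀ v : V, f v = F v) (v : V) :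
    partialDerivation V i f v = partialDIn V i F v :=
  partialDIn_congr i (fun y hy => (extendFn_coe f ⟨y, hy⟩).trans (h ⟨y, hy⟩)) v.2

theorem iterDerivation_partialDerivation (r : Fin n → ℕ)
    (f : ContMDiffMap (𝓡 n) 𝓘(ℝ, ℝ) V ℝ (⊤ : ℕ∞)) (v : V) :
    iterDerivation (fun i => partialDerivation V i) r (List.finRange n) f v =
      partialPowIn V r (extendFn V f) v := by
  have hiter : ∀ (i : Fin n) (m : ℕ) (g : ContMDiffMap (𝓡 n) 𝓘(ℝ, ℝ) V ℝ (⊤ : ℕ∞))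
      (G : EuclideanSpace ℝ (Fin n) → ℝ), (∀ v : V, g v = G v) →
      ∀ v : V, (partialDerivation V i)^[m] g v = (partialDIn V i)^[m] G v := by
    intro i m g G h
    induction m with
    | zero => exact h
    | succ m ih =>
      intro v
      rw [Function.iterate_succ_apply', Function.iterate_succ_apply']
      exact partialDerivation_eq_of_eqOn i ih v
  unfold partialPowIn
  generalize List.finRange n = l
  induction l generalizing v with
  | nil => exact (extendFn_coe f v).symm
  | cons i l ih => exact hiter i (r i) _ _ ih v

theorem partialDIn_coord_sub_const (i j : Fin n) (c : ℝ) {y : EuclideanSpace ℝ (Fin n)}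
    (hy : y ∈ V) : partialDIn V i (fun z => z j - c) y = if i = j then 1 else 0 := by
  have h : HasFDerivAt (fun z : EuclideanSpace ℝ (Fin n) => z j - c)
      (EuclideanSpace.proj j : EuclideanSpace ℝ (Fin n) →L[ℝ] ℝ) y :=
    (EuclideanSpace.proj j : EuclideanSpace ℝ (Fin n) →L[ℝ] ℝ).hasFDerivAt.sub_const c
  rw [partialDIn, fderivWithin_of_isOpen V.isOpen hy, h.fderiv]
  simp [eq_comm]

/-- Evaluation at a point of `V`, as an algebra map `C^∞(V) → ℝ`. -/
noncomputable def evalAlgHom (v : V) : ContMDiffMap (𝓡 n) 𝓘(ℝ, ℝ) V ℝ (⊤ : ℕ∞) →ₐ[ℝ] ℝ :=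
  (Pi.evalAlgHom ℝ (fun _ : V => ℝ) v).comp ContMDiffMap.coeFnAlgHom

theorem evalAlgHom_apply (v : V) (f : ContMDiffMap (𝓡 n) 𝓘(ℝ, ℝ) V ℝ (⊤ : ℕ∞)) :
    evalAlgHom v f = f v :=
  rfl

end SmoothFunctions

theorem map_mem_grassmannFiltration {q : ℕ} {A : Type*} [CommRing A] {I : Ideal A}
    (χ : A →+* ExteriorAlgebra ℝ (Fin q → ℝ))
    (hI : ∀ x ∈ I, χ x ∈ grassmannFiltration q 2) {k : ℕ} {x : A} (hx : x ∈ I ^ (k + 1)) :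
    χ x ∈ grassmannFiltration q (2 * (k + 1)) := by
  induction k generalizing x with
  | zero => exact hI x (by simpa using hx)
  | succ k ih =>
    rw [pow_succ] at hx
    refine Submodule.mul_induction_on hx (fun a ha b hb => ?_) fun a b ha hb => ?_
    · rw [map_mul]
      exact grassmannFiltration_mul_le q _ _ (Submodule.mul_mem_mul (ih ha) (hI b hb))
    · rw [map_add]
      exact Submodule.add_mem _ ha hb

/-- super Taylor formula.  If `χ = (φ* evaluated at x₀)` is an
ℝ-linear, even-valued ring homomorphism from `C^∞(V)` (`V ⊆ ℝⁿ` open and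
star-shaped around `y₀`) to the Grassmann algebra, whose coordinate images
decompose as `χ(y^α) = y₀^α + n^α` with `n^α` in the augmentation ideal, then
`χ(F) = Σ_{|r| ≤ ⌊q/2⌋} (∂^r F/∂y^r)(y₀) (χ(y) − y₀)^r / r!`. -/
theorem super_taylor (n q : ℕ)
    (V : TopologicalSpace.Opens (EuclideanSpace ℝ (Fin n)))
    (y₀ : EuclideanSpace ℝ (Fin n)) (hy₀ : y₀ ∈ V)
    (hstar : StarConvex ℝ y₀ (V : Set (EuclideanSpace ℝ (Fin n))))
    (χ : ContMDiffMap (𝓡 n) 𝓘(ℝ, ℝ) V ℝ (⊤ : ℕ∞) →+* ExteriorAlgebra ℝ (Fin q → ℝ))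
    (hlin : ∀ (c : ℝ) f, χ (c • f) = c • χ f)
    (heven : ∀ f, χ f ∈ CliffordAlgebra.even (0 : QuadraticForm ℝ (Fin q → ℝ)))
    (Y : Fin n → ContMDiffMap (𝓡 n) 𝓘(ℝ, ℝ) V ℝ (⊤ : ℕ∞))
    (hY : ∀ (α : Fin n) (v : V), Y α v = (v : EuclideanSpace ℝ (Fin n)) α)
    (hnilp : ∀ α : Fin n, ExteriorAlgebra.algebraMapInv
      (χ (Y α) - algebraMap ℝ (ExteriorAlgebra ℝ (Fin q → ℝ)) (y₀ α)) = 0) :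
    ∀ f : ContMDiffMap (𝓡 n) 𝓘(ℝ, ℝ) V ℝ (⊤ : ℕ∞),
      χ f = ∑ r ∈ (Fintype.piFinset fun _ : Fin n =>
            Finset.range (q / 2 + 2)).filter (fun r => ∑ i, r i ≤ q / 2),
        (partialPowIn (V : Set (EuclideanSpace ℝ (Fin n))) r (extendFn V f) y₀
            / ∏ i, (r i).factorial) •
          (List.ofFn fun α =>
            (χ (Y α) - algebraMap ℝ (ExteriorAlgebra ℝ (Fin q → ℝ)) (y₀ α))
              ^ r α).prod := by
  intro f
  let ε := evalAlgHom (⟨y₀, hy₀⟩ : V)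
  let χ' : ContMDiffMap (𝓡 n) 𝓘(ℝ, ℝ) V ℝ (⊤ : ℕ∞) →ₐ[ℝ] ExteriorAlgebra ℝ (Fin q → ℝ) :=
    AlgHom.ofLinearMap { χ with map_smul' := hlin } χ.map_one χ.map_mul
  let u : Fin n → ContMDiffMap (𝓡 n) 𝓘(ℝ, ℝ) V ℝ (⊤ : ℕ∞) :=
    fun i => Y i - algebraMap ℝ _ (y₀ i)
  have hu : ∀ i (v : V), u i v = (v : EuclideanSpace ℝ (Fin n)) i - y₀ i := fun i v =>
    congrArg (· - y₀ i) (hY i v)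
  have hχu : ∀ i, χ (u i) = χ (Y i) - algebraMap ℝ _ (y₀ i) := fun i =>
    (map_sub χ _ _).trans (congrArg _ (χ'.commutes (y₀ i)))
  have hI : ∀ x ∈ Ideal.span (Set.range u), χ x ∈ grassmannFiltration q 2 := by
    intro x hx
    refine mem_grassmannFiltration_two (heven x) ?_
    suffices Ideal.span (Set.range u) ≤
        RingHom.ker ((ExteriorAlgebra.algebraMapInv (R := ℝ) (M := Fin q → ℝ)).comp χ') from
      this hx
    rw [Ideal.span_le]
    rintro _ ⟨i, rfl⟩
    exact (congrArg _ (hχu i)).trans (hnilp i)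
  have hkill : ∀ x ∈ Ideal.span (Set.range u) ^ (q / 2 + 1), χ' x = 0 := by
    intro x hx
    have h := map_mem_grassmannFiltration χ hI hx
    rwa [grassmannFiltration_eq_bot (by omega), Submodule.mem_bot] at h
  have hDu : ∀ i j, partialDerivation V i (u j) = if i = j then 1 else 0 := by
    intro i j
    ext v
    rw [partialDerivation_eq_of_eqOn (F := fun z => z j - y₀ j) i (hu j) v,
      partialDIn_coord_sub_const i j _ v.2]
    split_ifs <;> rfl
  have hadamard : ∀ f, ∃ g : Fin n → ContMDiffMap (𝓡 n) 𝓘(ℝ, ℝ) V ℝ (⊤ : ℕ∞),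
      f = algebraMap ℝ _ (ε f) + ∑ i, u i * g i := by
    intro f
    obtain ⟨g, hg, h⟩ := exists_contDiffOn_eq_add_sum_mul V.isOpen hstar (contDiffOn_extendFn f)
    have hlift : ∀ i, ∃ g' : ContMDiffMap (𝓡 n) 𝓘(ℝ, ℝ) V ℝ (⊤ : ℕ∞), ∀ v : V, g' v = g i v :=
      fun i => ⟨⟨fun v => g i v, contMDiff_restrict_iff.2 (hg i)⟩, fun _ => rfl⟩
    choose g' hg' using hlift
    refine ⟨g', ?_⟩
    ext v
    have hv := h v v.2
    rw [extendFn_coe, extendFn_coe f ⟨y₀, hy₀⟩] at hv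
    rw [hv, ← evalAlgHom_apply v, map_add, map_sum, AlgHom.commutes]
    simp_rw [map_mul, evalAlgHom_apply, hu, hg']
    rfl
  have key := algHom_taylor (k := q / 2) (fun i => partialDerivation V i) ε u hDu
    (fun i => (hu i ⟨y₀, hy₀⟩).trans (sub_self _)) hadamard χ' hkill
    ((Fintype.piFinset fun _ : Fin n => Finset.range (q / 2 + 2)).filter
      (fun r => ∑ i, r i ≤ q / 2)) (fun r => ?_) f
  · refine key.trans (Finset.sum_congr rfl fun r _ => ?_)
    rw [evalAlgHom_apply, iterDerivation_partialDerivation]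
    congr 1
    congr 2
    ext i
    exact congrArg (· ^ r i) (hχu i)
  · simp only [Finset.mem_filter, Fintype.mem_piFinset, Finset.mem_range, and_iff_right_iff_imp]
    intro hr i
    have := Finset.single_le_sum (f := r) (fun _ _ => Nat.zero_le _) (Finset.mem_univ i)
    omega
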